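/- If g : ℝ → ℝ is smooth and even (g(−s) = g(s) for all s), then there exists a smooth h : ℝ → ℝ with g(s) = h(s²) for all s (Whitney's theorem on even functions). -/

import Mathlib

open Set Filter Topology in
lemma we_contDiff_seq (G : ℕ → ℝ → ℝ) (h : ∀ k t, HasDerivAt (G k) (G (k+1) t) t) (k : ℕ) :
    ContDiff ℝ (⊤ : ℕ∞) (G k) := by
  have key : ∀ n k : ℕ, ContDiff ℝ n (G k) := by
    intro n
    induction n with
    | zero =>
      intro k
      exact contDiff_zero.2 (continuous_iff_continuousAt.2 fun t => (h k t).continuousAt)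
    | succ n ih =>
      intro k
      have hd : deriv (G k) = G (k+1) := funext fun t => (h k t).deriv
      have := contDiff_succ_iff_deriv (𝕜 := ℝ) (f := G k) (n := (n : WithTop ℕ∞))
      push_cast
      rw [this, hd]
      exact ⟨fun t => (h k t).differentiableAt, by simp, ih (k+1)⟩
  exact contDiff_infty.2 fun n => key n k

lemma we_smooth_deriv {f : ℝ → ℝ} (hf : ContDiff ℝ (⊤ : ℕ∞) f) :
    ContDiff ℝ (⊤ : ℕ∞) (deriv f) := (contDiff_infty_iff_deriv.1 hf).2

lemma we_smooth_iter {f : ℝ → ℝ} (hf : ContDiff ℝ (⊤ : ℕ∞) f) (n : ℕ) :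
    ContDiff ℝ (⊤ : ℕ∞) (iteratedDeriv n f) := by
  induction n with
  | zero => simpa using hf
  | succ n ih => rw [iteratedDeriv_succ]; exact we_smooth_deriv ih

lemma we_iter_hasDeriv {f : ℝ → ℝ} (hf : ContDiff ℝ (⊤ : ℕ∞) f) (n : ℕ) (t : ℝ) :
    HasDerivAt (iteratedDeriv n f) (iteratedDeriv (n+1) f t) t := by
  rw [iteratedDeriv_succ]
  exact ((we_smooth_iter hf n).differentiable (by simp) t).hasDerivAt

open Set Filter Topology in
lemma we_integral_deriv {f : ℝ → ℝ} (hf : ContDiff ℝ (⊤ : ℕ∞) f) (n : ℕ) (s : ℝ) :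
    HasDerivAt (fun s => ∫ t in (0:ℝ)..1, t ^ n * f (t * s))
      (∫ t in (0:ℝ)..1, t ^ (n+1) * deriv f (t * s)) s := by
  have hc := hf.continuous
  have hc' := (we_smooth_deriv hf).continuous
  have hF' : Continuous (fun p : ℝ × ℝ => p.2 ^ (n+1) * deriv f (p.2 * p.1)) := by fun_prop
  obtain ⟨C, hC⟩ := ((isCompact_Icc (a := s-1) (b := s+1)).prod
    (isCompact_Icc (a := (0:ℝ)) (b := 1))).exists_bound_of_continuousOn hF'.continuousOn
  refine (intervalIntegral.hasDerivAt_integral_of_dominated_loc_of_deriv_le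
    (F := fun s t => t ^ n * f (t * s)) (F' := fun s t => t ^ (n+1) * deriv f (t * s))
    (s := Icc (s-1) (s+1)) (bound := fun _ => C) (Icc_mem_nhds (by linarith) (by linarith))
    ?_ ?_ ?_ ?_ ?_ ?_).2
  · exact Eventually.of_forall fun x =>
      (by fun_prop : Continuous fun t => t ^ n * f (t * x)).aestronglyMeasurable
  · exact (by fun_prop : Continuous fun t => t ^ n * f (t * s)).intervalIntegrable _ _
  · exact (by fun_prop : Continuous fun t => t ^ (n+1) * deriv f (t * s)).aestronglyMeasurable
  · refine Eventually.of_forall fun t ht x hx => hC (x, t) ⟨hx, ?_⟩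
    rw [uIoc_of_le zero_le_one] at ht
    exact ⟨ht.1.le, ht.2⟩
  · exact continuous_const.intervalIntegrable _ _
  · refine Eventually.of_forall fun t ht x hx => ?_
    have h1 : HasDerivAt f (deriv f (t * x)) (t * x) :=
      (hf.differentiable (by simp) _).hasDerivAt
    have h2 : HasDerivAt (fun x => t * x) t x := by
      simpa using (hasDerivAt_id x).const_mul t
    have := (h1.comp x h2).const_mul (t ^ n)
    have e : t ^ n * (deriv f (t * x) * t) = t ^ (n+1) * deriv f (t * x) := by ring
    rw [e] at this
    exact this

lemma we_integral_smooth {f : ℝ → ℝ} (hf : ContDiff ℝ (⊤ : ℕ∞) f) :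
    ContDiff ℝ (⊤ : ℕ∞) (fun s => ∫ t in (0:ℝ)..1, f (t * s)) := by
  have := we_contDiff_seq (fun n s => ∫ t in (0:ℝ)..1, t ^ n * iteratedDeriv n f (t * s))
    (fun k s => by
      simpa only [iteratedDeriv_succ] using we_integral_deriv (we_smooth_iter hf k) k s) 0
  simpa using this

/-- The operator `u ↦ u'(s)/(2s)` on even functions. -/
lemma we_step (u : ℝ → ℝ) (hu : ContDiff ℝ (⊤ : ℕ∞) u) (he : ∀ s, u (-s) = u s) :
    ∃ w : ℝ → ℝ, ContDiff ℝ (⊤ : ℕ∞) w ∧ (∀ s, w (-s) = w s) ∧ ∀ s, deriv u s = 2 * s * w s := by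
  have hodd : ∀ s, deriv u (-s) = - deriv u s := by
    intro s
    have h1 : deriv (fun x => u (-x)) s = - deriv u (-s) := deriv_comp_neg u s
    rw [show (fun x => u (-x)) = u from funext he] at h1
    linarith
  have hev : ∀ s, deriv (deriv u) (-s) = deriv (deriv u) s := by
    intro s
    have h1 : deriv (fun x => deriv u (-x)) s = - deriv (deriv u) (-s) := deriv_comp_neg _ s
    rw [show (fun x => deriv u (-x)) = fun x => - deriv u x from funext hodd] at h1
    rw [deriv.fun_neg] at h1
    linarith
  have h0 : deriv u 0 = 0 := by
    have := hodd 0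
    rw [neg_zero] at this
    linarith
  have hd := we_smooth_deriv hu
  have hdd := we_smooth_deriv hd
  refine ⟨fun s => (1/2) * ∫ t in (0:ℝ)..1, deriv (deriv u) (t * s),
    contDiff_const.mul (we_integral_smooth hdd), fun s => ?_, fun s => ?_⟩
  · simp only [mul_neg, hev]
  · have hc := hdd.continuous
    have : ∫ t in (0:ℝ)..1, s * deriv (deriv u) (t * s) = deriv u (1 * s) - deriv u (0 * s) := by
      refine intervalIntegral.integral_eq_sub_of_hasDerivAt (f := fun t => deriv u (t * s))
        (fun t _ => ?_) ((by fun_prop : Continuous fun t => s * deriv (deriv u) (t * s)).intervalIntegrable _ _)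
      have h1 : HasDerivAt (deriv u) (deriv (deriv u) (t * s)) (t * s) :=
        (hd.differentiable (by simp) _).hasDerivAt
      have h2 : HasDerivAt (fun t => t * s) s t := by
        simpa using (hasDerivAt_id t).mul_const s
      have := h1.comp t h2
      rw [mul_comm] at this
      exact this
    rw [intervalIntegral.integral_const_mul, one_mul, zero_mul, h0, sub_zero] at this
    rw [← this]
    ring

open Set Filter Topology in
/-- Borel's lemma. -/
lemma we_borel (a : ℕ → ℝ) :
    ∃ b : ℝ → ℝ, ContDiff ℝ (⊤ : ℕ∞) b ∧ ∀ k, iteratedDeriv k b 0 = a k := by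
  let χ : ContDiffBump (0:ℝ) := ⟨1, 2, by norm_num, by norm_num⟩
  let ψ : ℕ → ℝ → ℝ := fun i x => x ^ i * χ x
  have hψ : ∀ i, ContDiff ℝ (⊤ : ℕ∞) (ψ i) := fun i => (contDiff_id.pow i).mul χ.contDiff
  have hψs : ∀ i, HasCompactSupport (ψ i) := fun i => χ.hasCompactSupport.mul_left
  have hB : ∀ i k, ∃ C, ∀ x, ‖iteratedDeriv k (ψ i) x‖ ≤ C := by
    intro i k
    have hcs : HasCompactSupport (iteratedDeriv k (ψ i)) := by
      induction k with
      | zero => simpa using hψs i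
      | succ k ih => rw [iteratedDeriv_succ]; exact ih.deriv
    exact hcs.exists_bound_of_continuous (we_smooth_iter (hψ i) k).continuous
  choose B hB using hB
  have hB0 : ∀ i k, 0 ≤ B i k := fun i k => (norm_nonneg _).trans (hB i k 0)
  let d : ℕ → ℝ := fun i => a i / (i.factorial : ℝ)
  let L : ℕ → ℝ := fun i => 1 + 2 ^ i * (|d i| * ∑ k ∈ Finset.range i, B i k)
  have hS0 : ∀ i, 0 ≤ |d i| * ∑ k ∈ Finset.range i, B i k := fun i =>
    mul_nonneg (abs_nonneg _) (Finset.sum_nonneg fun k _ => hB0 i k)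
  have hL1 : ∀ i, 1 ≤ L i := fun i => by
    have : 0 ≤ 2 ^ i * (|d i| * ∑ k ∈ Finset.range i, B i k) := mul_nonneg (by positivity) (hS0 i)
    simp only [L]; linarith
  have hL0 : ∀ i, 0 < L i := fun i => lt_of_lt_of_le one_pos (hL1 i)
  let f : ℕ → ℝ → ℝ := fun i t => (d i / L i ^ i) * ψ i (L i * t)
  have hf : ∀ i, ContDiff ℝ (⊤ : ℕ∞) (f i) := fun i =>
    contDiff_const.mul ((hψ i).comp (contDiff_const.mul contDiff_id))
  have hfd : ∀ i k t, iteratedDeriv k (f i) t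
      = (d i / L i ^ i) * (L i ^ k * iteratedDeriv k (ψ i) (L i * t)) := by
    intro i k t
    have h1 := iteratedDeriv_comp_const_mul (n := k) ((hψ i).of_le (by exact_mod_cast le_top)) (L i)
    have h2 := congrFun h1 t
    simp only [f]
    rw [iteratedDeriv_const_mul_field, h2]
  let v : ℕ → ℕ → ℝ := fun k i =>
    if i ≤ k then |d i / L i ^ i| * (L i ^ k * B i k) else (1/2) ^ i
  have hv : ∀ k, Summable (v k) := by
    intro k
    refine (summable_geometric_of_lt_one (r := (1/2 : ℝ)) (by norm_num) (by norm_num)).congr_cofinite ?_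
    rw [Nat.cofinite_eq_atTop]
    filter_upwards [eventually_gt_atTop k] with i hi
    simp [v, not_le.2 hi]
  have hfv : ∀ k i x, ‖iteratedFDeriv ℝ k (f i) x‖ ≤ v k i := by
    intro k i x
    rw [norm_iteratedFDeriv_eq_norm_iteratedDeriv, hfd, norm_mul, norm_mul, Real.norm_eq_abs,
      Real.norm_of_nonneg (pow_nonneg (hL0 i).le k)]
    have hle : |d i / L i ^ i| * (L i ^ k * ‖iteratedDeriv k (ψ i) (L i * x)‖)
        ≤ |d i / L i ^ i| * (L i ^ k * B i k) := by
      have := hB i k (L i * x)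
      have := hL0 i
      gcongr
    refine hle.trans ?_
    by_cases hik : i ≤ k
    · simp [v, hik]
    · simp only [v, hik, if_false]
      have hki : k < i := not_le.1 hik
      rw [abs_div, abs_of_pos (pow_pos (hL0 i) i)]
      have hBS : B i k ≤ ∑ k ∈ Finset.range i, B i k :=
        Finset.single_le_sum (f := fun k => B i k) (fun k _ => hB0 i k) (Finset.mem_range.2 hki)
      have hX : 2 ^ i * (|d i| * B i k) ≤ L i := by
        have : 2 ^ i * (|d i| * B i k) ≤ 2 ^ i * (|d i| * ∑ k ∈ Finset.range i, B i k) := by gcongr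
        simp only [L]; linarith
      have hp : L i ^ k * L i ≤ L i ^ i := by
        rw [← pow_succ]; exact pow_le_pow_right₀ (hL1 i) hki
      rw [div_mul_eq_mul_div, div_le_iff₀ (pow_pos (hL0 i) i), one_div, inv_pow,
        ← div_eq_inv_mul, le_div_iff₀ (by positivity)]
      calc |d i| * (L i ^ k * B i k) * 2 ^ i = L i ^ k * (2 ^ i * (|d i| * B i k)) := by ring
        _ ≤ L i ^ k * L i := by
          have := hL0 i
          gcongr
        _ ≤ _ := hp
  refine ⟨fun t => ∑' i, f i t, contDiff_tsum hf (fun k _ => hv k) (fun k i x _ => hfv k i x), ?_⟩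
  intro k
  have hz : ∀ i, iteratedDeriv k (f i) 0 = if i = k then a k else 0 := by
    intro i
    have hev : f i =ᶠ[𝓝 0] fun t => d i * t ^ i := by
      have h1 : χ =ᶠ[𝓝 0] 1 := χ.eventuallyEq_one
      have h2 : Tendsto (fun t : ℝ => L i * t) (𝓝 0) (𝓝 0) := by
        have : Continuous (fun t : ℝ => L i * t) := by fun_prop
        simpa using this.tendsto 0
      filter_upwards [h2.eventually h1] with t ht
      have := (pow_pos (hL0 i) i).ne'
      simp only [f, ψ, ht, Pi.one_apply, mul_one, mul_pow]
      field_simp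
    rw [hev.iteratedDeriv_eq, iteratedDeriv_const_mul_field, iteratedDeriv_fun_pow_zero]
    by_cases hik : i = k
    · subst hik
      have : (i.factorial : ℝ) ≠ 0 := by positivity
      simp [d]
      field_simp
    · simp [hik, Ne.symm hik]
  rw [iteratedDeriv_eq_iteratedFDeriv,
    iteratedFDeriv_tsum_apply hf (fun k _ => hv k) (fun k i x _ => hfv k i x) (by exact_mod_cast le_top)]
  rw [tsum_eq_single k]
  · rw [← iteratedDeriv_eq_iteratedFDeriv, hz]; simp
  · intro i hi
    ext
    rw [iteratedFDeriv_apply_eq_iteratedDeriv_mul_prod, hz]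
    simp [hi]

open Set Filter Topology in
/-- Whitney's theorem on even functions: every smooth even function `g : ℝ → ℝ` is of the form
`g(s) = h(s²)` for some smooth `h : ℝ → ℝ`. -/
theorem whitney_even (g : ℝ → ℝ) (hg : ContDiff ℝ (⊤ : ℕ∞) g) (heven : ∀ s, g (-s) = g s) :
    ∃ h : ℝ → ℝ, ContDiff ℝ (⊤ : ℕ∞) h ∧ ∀ s, g s = h (s ^ 2) := by
  choose D hD1 hD2 hD3 using we_step
  let U : ℕ → {u : ℝ → ℝ // ContDiff ℝ (⊤ : ℕ∞) u ∧ ∀ s, u (-s) = u s} := fun n =>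
    Nat.rec ⟨g, hg, heven⟩ (fun _ u => ⟨D u.1 u.2.1 u.2.2, hD1 _ _ _, hD2 _ _ _⟩) n
  have hU : ∀ n s, deriv (U n).1 s = 2 * s * (U (n+1)).1 s := fun n s =>
    hD3 (U n).1 (U n).2.1 (U n).2.2 s
  obtain ⟨b, hb, hb0⟩ := we_borel fun k => (U k).1 0
  let G : ℕ → ℝ → ℝ := fun k t => if t ≤ 0 then iteratedDeriv k b t else (U k).1 (√t)
  have hGc : ∀ k, Continuous (G k) := by
    intro k
    refine Continuous.if_le (we_smooth_iter hb k).continuous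
      ((U k).2.1.continuous.comp Real.continuous_sqrt) continuous_id continuous_const ?_
    intro t ht
    have ht : t = 0 := ht
    simp [ht, hb0]
  have hG : ∀ k t, HasDerivAt (G k) (G (k+1) t) t := by
    intro k t
    refine hasDerivAt_of_hasDerivAt_of_ne' (x := 0) (fun y hy => ?_) (hGc k).continuousAt
      (hGc (k+1)).continuousAt t
    rcases lt_or_gt_of_ne hy with hy | hy
    · have h1 : G (k+1) y = iteratedDeriv (k+1) b y := if_pos hy.le
      rw [h1]
      refine (we_iter_hasDeriv hb k y).congr_of_eventuallyEq ?_
      filter_upwards [Iio_mem_nhds hy] with z hz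
      exact if_pos (le_of_lt hz)
    · have h1 : G (k+1) y = (U (k+1)).1 (√y) := if_neg (not_le.2 hy)
      rw [h1]
      have hs : 0 < √y := Real.sqrt_pos.2 hy
      have h2 : HasDerivAt (fun t => (U k).1 (√t)) (deriv (U k).1 (√y) * (1 / (2 * √y))) y :=
        (((U k).2.1.differentiable (by simp) (√y)).hasDerivAt).comp y (Real.hasDerivAt_sqrt hy.ne')
      have h3 : deriv (U k).1 (√y) * (1 / (2 * √y)) = (U (k+1)).1 (√y) := by
        rw [hU]; field_simp
      rw [h3] at h2
      refine h2.congr_of_eventuallyEq ?_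
      filter_upwards [Ioi_mem_nhds hy] with z hz
      exact if_neg (not_le.2 hz)
  refine ⟨G 0, we_contDiff_seq G hG 0, fun s => ?_⟩
  by_cases hs : s = 0
  · subst hs
    have := hb0 0
    simp only [G]
    simp only [ne_eq, OfNat.ofNat_ne_zero, not_false_eq_true, zero_pow, le_refl, if_true]
    rw [this]
    rfl
  · have : ¬ (s ^ 2 ≤ 0) := not_le.2 (by positivity)
    simp only [G, this, if_false, Real.sqrt_sq_eq_abs]
    change g s = g |s|
    rcases abs_choice s with h | h <;> rw [h]
    exact (heven s).symm
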